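/- Let σ₁, σ₂ be commuting involutions of g with quaternionic decomposition g = g₀₀ ⊕ g₀₁ ⊕ g₁₀ ⊕ g₁₁, and suppose σ₁ is of maximal rank. Then any Cartan subspace of g₁₀ is also a Cartan subspace of g₁₀ ⊕ g₀₁ (the (−1)-eigenspace of σ₃ = σ₁σ₂). -/

import Mathlib

open LieAlgebra Module

variable (k : Type*) [Field k] [IsAlgClosed k] [CharZero k]
variable (g : Type*) [LieRing g] [LieAlgebra k g] [FiniteDimensional k g]
  [LieAlgebra.IsSemisimple k g]

/-- The eigenspace of a Lie algebra automorphism `σ` for the eigenvalue `c`. -/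
noncomputable def eigSub (σ : g ≃ₗ⁅k⁆ g) (c : k) : Submodule k g :=
  Module.End.eigenspace (σ.toLinearEquiv : g →ₗ[k] g) c

/-- A Lie algebra involution: an automorphism `σ` with `σ ∘ σ = id`. -/
def IsInvolution (σ : g ≃ₗ⁅k⁆ g) : Prop := ∀ x, σ (σ x) = x

/-- Two commuting involutions. -/
def CommutingInvolutions (σ₁ σ₂ : g ≃ₗ⁅k⁆ g) : Prop :=
  IsInvolution k g σ₁ ∧ IsInvolution k g σ₂ ∧ ∀ x, σ₁ (σ₂ x) = σ₂ (σ₁ x)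

/-- The subspace `g_{ij}` of the quaternionic decomposition determined by commuting
involutions `σ₁, σ₂`: here `i, j : Bool` and `false, true` encode the exponents `0, 1`
of the eigenvalues `(-1)^i`, `(-1)^j`. -/
noncomputable def qSpace (σ₁ σ₂ : g ≃ₗ⁅k⁆ g) (i j : Bool) : Submodule k g :=
  eigSub k g σ₁ (if i then -1 else 1) ⊓ eigSub k g σ₂ (if j then -1 else 1)

/-- `x` is a semisimple element of `g`: `ad x` is a semisimple endomorphism. -/
def IsSSElt (x : g) : Prop := Module.End.IsSemisimple (ad k g x)

/-- `x` is a nilpotent element of `g`: `ad x` is a nilpotent endomorphism. -/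
def IsNilpElt (x : g) : Prop := IsNilpotent (ad k g x)

/-- `x` is a regular element of `g`: the dimension of its centralizer equals the rank of `g`,
i.e. the dimension of a Cartan subalgebra of `g`. -/
def IsRegElt (x : g) : Prop :=
  ∃ H : LieSubalgebra k g, H.IsCartanSubalgebra ∧
    Module.finrank k (LinearMap.ker (ad k g x)) = Module.finrank k H

/-- An involution is of maximal rank if its `(-1)`-eigenspace contains a Cartan
subalgebra of `g`. -/
def IsMaxRank (σ : g ≃ₗ⁅k⁆ g) : Prop :=
  ∃ H : LieSubalgebra k g, H.IsCartanSubalgebra ∧ H.toSubmodule ≤ eigSub k g σ (-1)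

/-- The centralizer of an element `x`, as a Lie subalgebra of `g`. -/
def zg (x : g) : LieSubalgebra k g where
  carrier := {y | ⁅x, y⁆ = 0}
  add_mem' := by
    intro a b ha hb
    simp only [Set.mem_setOf_eq] at *
    rw [lie_add, ha, hb, add_zero]
  zero_mem' := by simp
  smul_mem' := by
    intro t a ha
    simp only [Set.mem_setOf_eq] at *
    rw [lie_smul, ha, smul_zero]
  lie_mem' := by
    intro a b ha hb
    simp only [Set.mem_setOf_eq] at *
    rw [leibniz_lie, ha, hb, lie_zero, zero_lie, add_zero]

/-- The fixed-point subalgebra of a Lie algebra automorphism. -/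
def fixSubalgebra (σ : g ≃ₗ⁅k⁆ g) : LieSubalgebra k g where
  carrier := {x | σ x = x}
  add_mem' := by
    intro a b ha hb
    simp only [Set.mem_setOf_eq] at *
    rw [show σ (a + b) = σ a + σ b from σ.toLieHom.map_add a b, ha, hb]
  zero_mem' := by simp only [Set.mem_setOf_eq]; exact σ.toLieHom.map_zero
  smul_mem' := by
    intro t a ha
    simp only [Set.mem_setOf_eq] at *
    rw [show σ (t • a) = t • σ a from σ.toLieHom.map_smul t a, ha]
  lie_mem' := by
    intro a b ha hb
    simp only [Set.mem_setOf_eq] at *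
    rw [LieEquiv.map_lie σ a b, ha, hb]

/-- The exponential of an endomorphism, as a finite sum (which is the genuine exponential
when the endomorphism is nilpotent). -/
noncomputable def expEnd (f : Module.End k g) : Module.End k g :=
  ∑ i ∈ Finset.range (Module.finrank k g + 1), (i.factorial : k)⁻¹ • f ^ i

/-- An automorphism of `g` is inner if it lies in the subgroup of automorphisms generated
by the exponentials `exp (ad x)` with `ad x` nilpotent. -/
noncomputable def IsInnerAut (μ : g ≃ₗ⁅k⁆ g) : Prop :=
  μ.toLinearEquiv ∈ Subgroup.closure
    {e : g ≃ₗ[k] g | ∃ x : g, IsNilpotent (ad k g x) ∧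
      (e : g →ₗ[k] g) = expEnd k g (ad k g x)}

/-- `σ` and `τ` are conjugate by an inner automorphism of `g`. -/
noncomputable def InnerConj (σ τ : g ≃ₗ⁅k⁆ g) : Prop :=
  ∃ φ : g ≃ₗ⁅k⁆ g, IsInnerAut k g φ ∧ ∀ x, τ x = φ (σ (φ.symm x))

/-- A dyad: a pair of distinct commuting involutions that are conjugate by an inner
automorphism of `g`. -/
noncomputable def IsDyad (σ₁ σ₂ : g ≃ₗ⁅k⁆ g) : Prop :=
  IsInvolution k g σ₁ ∧ IsInvolution k g σ₂ ∧ σ₁ ≠ σ₂ ∧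
    (∀ x, σ₁ (σ₂ x) = σ₂ (σ₁ x)) ∧ InnerConj k g σ₁ σ₂

/-- The span of all brackets `⁅x, y⁆` with `x, y` in a subspace `m`. -/
noncomputable def bracketSpan (m : Submodule k g) : Submodule k g :=
  Submodule.span k {z | ∃ x ∈ m, ∃ y ∈ m, z = ⁅x, y⁆}

/-- `c` is a Cartan subspace of a subspace `m ⊆ g`: it consists of pairwise commuting
semisimple elements of `g` and is maximal among such subspaces of `m`. -/
def IsCartanSubspace (m c : Submodule k g) : Prop :=
  c ≤ m ∧ (∀ x ∈ c, IsSSElt k g x) ∧ (∀ x ∈ c, ∀ y ∈ c, ⁅x, y⁆ = 0) ∧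
    ∀ c' : Submodule k g, c' ≤ m → (∀ x ∈ c', IsSSElt k g x) →
      (∀ x ∈ c', ∀ y ∈ c', ⁅x, y⁆ = 0) → c ≤ c' → c' = c


section Helpers
set_option linter.unusedSectionVars false

variable {k g}

lemma aux_finite_bad (f h : Module.End k g) (hc : Commute f h) (hs : h.IsSemisimple) :
    ∃ S : Set k, S.Finite ∧ ∀ t, t ∉ S → LinearMap.ker (f + t • h) ≤ LinearMap.ker h := by
  refine ⟨(fun q : k × k => -(q.1 / q.2)) '' ({a | f.HasEigenvalue a} ×ˢ {b | h.HasEigenvalue b}),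
    ?_, ?_⟩
  · exact (Set.Finite.prod f.finite_hasEigenvalue h.finite_hasEigenvalue).image _
  · intro t ht
    by_contra hcon
    apply ht
    have hinv' : ∀ v ∈ LinearMap.ker (f + t • h), h v ∈ LinearMap.ker (f + t • h) := by
      intro v hv
      simp only [LinearMap.mem_ker] at hv ⊢
      have h1 : f (h v) = h (f v) := LinearMap.congr_fun hc.eq v
      have h2 : h ((f + t • h) v) = 0 := by rw [hv, map_zero]
      simpa [h1] using h2
    have hinv : LinearMap.ker (f + t • h) ∈ h.invtSubmodule := fun v hv => hinv' v hv
    have hr := hs.restrict hinv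
    have hne : LinearMap.restrict h hinv' ≠ 0 := by
      intro h0
      apply hcon
      intro v hv
      have := congrArg Subtype.val (LinearMap.congr_fun h0 ⟨v, hv⟩)
      simpa using this
    rw [Ne, hr.eq_zero_iff_forall_eigenvalue] at hne
    push Not at hne
    obtain ⟨ν, hν, hν0⟩ := hne
    obtain ⟨⟨w, hw⟩, hw1, hw0⟩ := hν.exists_hasEigenvector
    have hhw : h w = ν • w := by
      exact congrArg Subtype.val (Module.End.mem_eigenspace_iff.mp hw1)
    have hw0' : w ≠ 0 := by
      intro h0; apply hw0; ext; exact h0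
    have hfw : f w = (-(t * ν)) • w := by
      have : f w + t • h w = 0 := by simpa using hw
      rw [hhw, smul_smul] at this
      rw [neg_smul]; exact eq_neg_of_add_eq_zero_left this
    refine ⟨(-(t * ν), ν), ⟨?_, ?_⟩, ?_⟩
    · exact Module.End.hasEigenvalue_of_hasEigenvector
        ⟨Module.End.mem_eigenspace_iff.mpr hfw, hw0'⟩
    · exact Module.End.hasEigenvalue_of_hasEigenvector
        ⟨Module.End.mem_eigenspace_iff.mpr hhw, hw0'⟩
    · simp; field_simp

lemma aux_ad_commute {x y : g} (h : ⁅x, y⁆ = 0) : Commute (ad k g x) (ad k g y) := by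
  ext z
  change ⁅x, ⁅y, z⁆⁆ = ⁅y, ⁅x, z⁆⁆
  rw [leibniz_lie, h, zero_lie, zero_add]

lemma aux_ad_inj {x : g} (h : ad k g x = 0) : x = 0 := by
  have h2 : LieDerivation.ad k g x = 0 := by
    ext y
    have := LinearMap.congr_fun h y
    simpa using this
  exact (LieDerivation.IsKilling.ad_apply_eq_zero_iff k g x).mp h2

lemma aux_lie_of_commute {x y : g} (h : Commute (ad k g x) (ad k g y)) : ⁅x, y⁆ = 0 := by
  apply aux_ad_inj (k := k)
  ext z
  have h1 : ⁅x, ⁅y, z⁆⁆ = ⁅y, ⁅x, z⁆⁆ := LinearMap.congr_fun h.eq z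
  simp [lie_lie, h1]

/-- generic element of a toral subspace -/
lemma aux_generic (c : Submodule k g) (hss : ∀ x ∈ c, IsSSElt k g x)
    (hab : ∀ x ∈ c, ∀ y ∈ c, ⁅x, y⁆ = 0) :
    ∃ x ∈ c, ∀ y : g, ⁅x, y⁆ = 0 → ∀ z ∈ c, ⁅z, y⁆ = 0 := by
  classical
  have hex : ∃ n, ∃ x ∈ c, finrank k (LinearMap.ker (ad k g x)) = n := ⟨_, 0, c.zero_mem, rfl⟩
  obtain ⟨x, hx, hxn⟩ := Nat.find_spec hex
  have hmin : ∀ y ∈ c, finrank k (LinearMap.ker (ad k g x)) ≤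
      finrank k (LinearMap.ker (ad k g y)) := by
    intro y hy
    rw [hxn]
    exact Nat.find_min' hex ⟨y, hy, rfl⟩
  refine ⟨x, hx, fun y hy z hz => ?_⟩
  obtain ⟨S, hS, hS'⟩ := aux_finite_bad (ad k g z) (ad k g x) (aux_ad_commute (hab z hz x hx))
    (hss x hx)
  obtain ⟨t, ht⟩ := hS.infinite_compl.nonempty
  have hle := hS' t ht
  have heq : ad k g z + t • ad k g x = ad k g (z + t • x) := by simp
  have h2 : LinearMap.ker (ad k g (z + t • x)) = LinearMap.ker (ad k g x) := by
    rw [heq] at hle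
    exact Submodule.eq_of_le_of_finrank_le hle
      (hmin _ (c.add_mem hz (c.smul_mem _ hx)))
  have h3 : y ∈ LinearMap.ker (ad k g (z + t • x)) := by rw [h2]; simpa using hy
  simpa [hy] using h3

/-- Abstract Jordan decomposition. -/
lemma aux_jordan (x : g) : ∃ n s : g, x = n + s ∧ IsNilpotent (ad k g n) ∧ IsSSElt k g s ∧
    ⁅n, s⁆ = 0 ∧ ∀ y : g, ⁅x, y⁆ = 0 → ⁅s, y⁆ = 0 := by
  obtain ⟨N, hN₀, S, hS₁, hN, hS, hSN⟩ := (ad k g x).exists_isNilpotent_isSemisimple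
  have hS₀ : Commute (ad k g x) S := Algebra.commute_of_mem_adjoin_self hS₁
  have hNS : Commute N S :=
    Algebra.commute_of_mem_adjoin_singleton_of_commute hS₁
      (Algebra.commute_of_mem_adjoin_self hN₀).symm
  have hN' := hN
  rw [eq_sub_of_add_eq hSN.symm] at hN'
  have aux {α : k} {y : g} (hy : y ∈ (ad k g x).maxGenEigenspace α) : S y = α • y := by
    rw [Module.End.maxGenEigenspace_eq] at hy
    rw [Module.End.apply_eq_of_mem_of_comm_of_isFinitelySemisimple_of_isNil hy hS₀
      hS.isFinitelySemisimple hN']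
  have h_der (y z : g) (α β : k) (hy : y ∈ (ad k g x).maxGenEigenspace α)
      (hz : z ∈ (ad k g x).maxGenEigenspace β) :
      S ⁅y, z⁆ = ⁅S y, z⁆ + ⁅y, S z⁆ := by
    have hyz : ⁅y, z⁆ ∈ (ad k g x).maxGenEigenspace (α + β) :=
      LieModule.lie_mem_maxGenEigenspace_toEnd hy hz
    rw [aux hy, aux hz, aux hyz, smul_lie, lie_smul, ← add_smul]
  replace h_der (y z : g) : S ⁅y, z⁆ = ⁅S y, z⁆ + ⁅y, S z⁆ := by
    have hy : y ∈ ⨆ α : k, (ad k g x).maxGenEigenspace α := by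
      rw [Module.End.iSup_maxGenEigenspace_eq_top]; trivial
    have hz : z ∈ ⨆ α : k, (ad k g x).maxGenEigenspace α := by
      rw [Module.End.iSup_maxGenEigenspace_eq_top]; trivial
    induction hy using Submodule.iSup_induction' with
    | mem α y hy =>
      induction hz using Submodule.iSup_induction' with
      | mem β z hz => exact h_der y z α β hy hz
      | zero => simp
      | add _ _ _ _ h h' => simp only [lie_add, map_add, h, h']; abel
    | zero => simp
    | add _ _ _ _ h h' => simp only [add_lie, map_add, h, h']; abel
  replace h_der : ∀ y z : g, S ⁅y, z⁆ = ⁅y, S z⁆ - ⁅z, S y⁆ := by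
    simp_rw [← lie_skew (S _) _, add_comm, ← sub_eq_add_neg] at h_der; assumption
  let S' : LieDerivation k g g := ⟨S, h_der⟩
  obtain ⟨s, hs⟩ := LieDerivation.IsKilling.exists_eq_ad S'
  have hs' : S = ad k g s := by rw [← LieDerivation.coe_ad_apply_eq_ad_apply s, hs]
  have hn' : ad k g (x - s) = N := by rw [map_sub, ← hs', hSN]; simp
  refine ⟨x - s, s, by abel, hn' ▸ hN, ?_, ?_, ?_⟩
  · unfold IsSSElt; rw [← hs']; exact hS
  · apply aux_lie_of_commute (k := k)
    rw [hn', ← hs']; exact hNS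
  · intro y hy
    apply aux_lie_of_commute (k := k)
    rw [← hs']
    exact (Algebra.commute_of_mem_adjoin_singleton_of_commute hS₁ (aux_ad_commute hy).symm).symm

lemma aux_jordan_sigma (σ : g ≃ₗ⁅k⁆ g) {ε : k} (hε : ε ≠ 0) {x n s : g} (hx : x = n + s)
    (hn : IsNilpotent (ad k g n)) (hs : IsSSElt k g s) (hns : ⁅n, s⁆ = 0) (hσ : σ x = ε • x) :
    σ s = ε • s := by
  have h1 : ad k g (σ n) + ad k g (σ s) = ad k g (ε • n) + ad k g (ε • s) := by
    rw [← map_add, ← map_add, ← map_add, ← smul_add, ← hx, hσ]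
  have hn1 : IsNilpotent (ad k g (σ n)) := by
    rw [← conj_ad_apply]
    obtain ⟨m, hm⟩ := hn
    refine ⟨m, ?_⟩
    have : ∀ j : ℕ, (σ.toLinearEquiv.conj (ad k g n)) ^ j = σ.toLinearEquiv.conj (ad k g n ^ j) :=
      fun j => (map_pow σ.toLinearEquiv.conjRingEquiv (ad k g n) j).symm
    rw [this, hm, map_zero]
  have hs1 : (ad k g (σ s)).IsSemisimple := by
    refine (LinearEquiv.isSemisimple_iff (ad k g s) (ad k g (σ s)) σ.toLinearEquiv ?_).mp hs
    ext y
    exact LieEquiv.map_lie σ s y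
  have hn2 : IsNilpotent (ad k g (ε • n)) := by rw [map_smul]; exact hn.smul ε
  have hs2 : (ad k g (ε • s)).IsSemisimple := by
    rw [map_smul]; exact Module.End.IsSemisimple_smul _ hs
  have hc1 : Commute (ad k g (σ n)) (ad k g (σ s)) := by
    apply aux_ad_commute; rw [← LieEquiv.map_lie, hns, map_zero]
  have hc2 : Commute (ad k g (ε • n)) (ad k g (ε • s)) := by
    apply aux_ad_commute; simp [hns]
  have := (Module.End.isNilpotent_isSemisimple_unique hn1 hs1 hn2 hs2 hc1 hc2 h1).2
  rw [← sub_eq_zero]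
  apply aux_ad_inj (k := k)
  rw [map_sub, this, sub_self]

end Helpers

section PolyHelpers
set_option linter.unusedSectionVars false
open MvPolynomial

/-- linear vector field -/
noncomputable def auxD {F : Type*} [Field F] {ι : Type*} [Fintype ι] (T : Matrix ι ι F) :
    Derivation F (MvPolynomial ι F) (MvPolynomial ι F) :=
  mkDerivation F (fun i => ∑ j, C (T i j) * X j)

noncomputable def auxW {F : Type*} [Field F] {ι : Type*} (f : MvPolynomial ι F) :
    ℕ → Submodule F (MvPolynomial ι F)
  | 0 => Submodule.span F {f}
  | n + 1 => Submodule.span F {p | ∃ i, ∃ q ∈ auxW f n, p = pderiv i q}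

variable {F : Type*} [Field F] {ι : Type*} [Fintype ι]

lemma aux_der_sum {R M : Type*} [CommRing R] [Algebra F R] [AddCommGroup M] [Module F M]
    [Module R M] {κ : Type*} (s : Finset κ)
    (D : κ → Derivation F R M) (x : R) : (∑ i ∈ s, D i) x = ∑ i ∈ s, D i x := by
  classical
  induction s using Finset.induction_on with
  | empty => simp
  | insert a s ha ih => rw [Finset.sum_insert ha, Finset.sum_insert ha, Derivation.add_apply, ih]

lemma auxD_apply (T : Matrix ι ι F) (f : MvPolynomial ι F) :
    auxD T f = ∑ i, (∑ j, C (T i j) * X j) * pderiv i f := by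
  classical
  have : auxD T = ∑ i, (∑ j, C (T i j) * X j : MvPolynomial ι F) • pderiv (R := F) i := by
    apply derivation_ext
    intro l
    simp [auxD, aux_der_sum, Pi.single_apply]
  rw [this, aux_der_sum]
  simp

lemma auxD_pderiv (T : Matrix ι ι F) (i : ι) (f : MvPolynomial ι F) :
    auxD T (pderiv i f) = pderiv i (auxD T f) - ∑ j, T j i • pderiv j f := by
  classical
  have : ⁅auxD T, pderiv (R := F) i⁆ = - ∑ j, T j i • pderiv (R := F) j := by
    apply derivation_ext
    intro l
    rw [Derivation.commutator_apply]
    simp [auxD, Pi.single_apply, aux_der_sum, smul_eq_C_mul, apply_ite]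
  have h2 := DFunLike.congr_fun this f
  rw [Derivation.commutator_apply] at h2
  rw [sub_eq_iff_eq_add] at h2
  rw [h2, Derivation.neg_apply, aux_der_sum]
  simp only [Derivation.smul_apply]
  abel

lemma auxW_mem (f : MvPolynomial ι F) (n : ℕ) (i : ι) (q : MvPolynomial ι F) (hq : q ∈ auxW f n) :
    pderiv i q ∈ auxW f (n + 1) := by
  rw [auxW]
  exact Submodule.subset_span ⟨i, q, hq, rfl⟩

lemma auxW_le (f : MvPolynomial ι F) (n : ℕ) (S : Submodule F (MvPolynomial ι F))
    (h : ∀ i, ∀ q ∈ auxW f n, pderiv i q ∈ S) : auxW f (n + 1) ≤ S := by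
  rw [auxW, Submodule.span_le]
  rintro _ ⟨i, q, hq, rfl⟩
  exact h i q hq

lemma auxW_zero (f p : MvPolynomial ι F) (hp : p ∈ auxW f 0) : ∃ a : F, a • f = p := by
  rw [auxW] at hp
  exact Submodule.mem_span_singleton.mp hp

lemma auxW_self (f : MvPolynomial ι F) : f ∈ auxW f 0 := by
  rw [auxW]
  exact Submodule.mem_span_singleton_self f

lemma auxW_stable (f : MvPolynomial ι F) (T : Matrix ι ι F) (hf : auxD T f = 0) (n : ℕ) :
    ∀ p ∈ auxW f n, auxD T p ∈ auxW f n := by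
  induction n with
  | zero =>
    intro p hp
    obtain ⟨a, rfl⟩ := auxW_zero f p hp
    rw [Derivation.map_smul, hf, smul_zero]; exact Submodule.zero_mem _
  | succ n ih =>
    intro p hp
    have hle : auxW f (n+1) ≤ (auxW f (n+1)).comap (auxD T).toLinearMap := by
      refine auxW_le f n _ fun i q hq => ?_
      rw [Submodule.mem_comap]
      change auxD T (pderiv i q) ∈ auxW f (n + 1)
      rw [auxD_pderiv]
      exact Submodule.sub_mem _ (auxW_mem f n _ _ (ih q hq))
        (Submodule.sum_mem _ fun j _ => Submodule.smul_mem _ _ (auxW_mem f n _ _ hq))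
    exact Submodule.mem_comap.mp (hle hp)

/-- restriction to a line -/
noncomputable def auxLine (x v : ι → F) : MvPolynomial ι F →ₐ[F] Polynomial F :=
  aeval (fun i => Polynomial.C (x i) + Polynomial.C (v i) * Polynomial.X)

lemma auxLine_eval (x v : ι → F) (f : MvPolynomial ι F) (t : F) :
    (auxLine x v f).eval t = eval (x + t • v) f := by
  have : (Polynomial.evalRingHom t).comp (auxLine x v).toRingHom = eval (x + t • v) := by
    apply ringHom_ext
    · intro r; simp [auxLine]
    · intro i; simp [auxLine]; ring
  exact RingHom.congr_fun this f

lemma auxLine_deriv (x v : ι → F) (f : MvPolynomial ι F) :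
    Polynomial.derivative (auxLine x v f) =
      ∑ i, Polynomial.C (v i) * auxLine x v (pderiv i f) := by
  classical
  induction f using MvPolynomial.induction_on with
  | C a => simp [auxLine]
  | add p q hp hq => simp [hp, hq, mul_add, Finset.sum_add_distrib]
  | mul_X p j hp =>
    rw [map_mul, Polynomial.derivative_mul, hp]
    simp only [Derivation.leibniz, pderiv_X, smul_eq_mul, map_add, map_mul, mul_add,
      Finset.sum_add_distrib]
    rw [add_comm]
    congr 1
    · rw [Finset.sum_eq_single j]
      · simp [auxLine]; ring
      · intro b _ hb; simp [hb]
      · simp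
    · rw [Finset.sum_mul]
      exact Finset.sum_congr rfl fun i _ => by ring

variable [CharZero F]

lemma aux_poly_main {U : Type*} (A : Submodule F (ι → F)) (T : U → Matrix ι ι F)
    (f : MvPolynomial ι F) (hD : ∀ u, auxD (T u) f = 0) (hA : ∀ x ∈ A, eval x f = 0)
    (x₀ : ι → F) (hx₀ : x₀ ∈ A)
    (hG : ∀ x ∈ A, ∃ S : Set F, S.Finite ∧ ∀ t ∉ S, ∀ v : ι → F, ∃ a ∈ A, ∃ u,
      v = a + (T u).mulVec (x + t • x₀)) : f = 0 := by
  classical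
  have hW : ∀ n, ∀ p ∈ auxW f n, ∀ x ∈ A, eval x p = 0 := by
    intro n
    induction n with
    | zero =>
      intro p hp x hx
      obtain ⟨a, rfl⟩ := auxW_zero f p hp
      simp [smul_eq_C_mul, hA x hx]
    | succ n ih =>
      intro p hp x hx
      suffices auxW f (n+1) ≤ LinearMap.ker (aeval (R := F) x).toLinearMap by
        have := this hp
        simpa [aeval_eq_eval] using this
      refine auxW_le f n _ fun i q hq => ?_
      change aeval x (pderiv i q) = 0
      rw [aeval_eq_eval]
      change eval x (pderiv i q) = 0
      obtain ⟨S, hS, hS'⟩ := hG x hx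
      -- vanishing at generic points
      have hgen : ∀ t ∉ S, eval (x + t • x₀) (pderiv i q) = 0 := by
        intro t ht
        set y := x + t • x₀ with hy
        have hyA : y ∈ A := A.add_mem hx (A.smul_mem _ hx₀)
        obtain ⟨a, ha, u, hau⟩ := hS' t ht (Pi.single i 1)
        have h1 : ∑ j, a j * eval y (pderiv j q) = 0 := by
          have hz : auxLine y a q = 0 := by
            apply Polynomial.funext
            intro s
            rw [auxLine_eval, Polynomial.eval_zero]
            exact ih q hq _ (A.add_mem hyA (A.smul_mem _ ha))
          have h := auxLine_deriv y a q
          rw [hz, Polynomial.derivative_zero] at h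
          have h' := congrArg (Polynomial.eval 0) h
          simp only [Polynomial.eval_finsetSum, Polynomial.eval_mul, auxLine_eval] at h'
          simpa using h'.symm
        have h2 : ∑ j, (T u).mulVec y j * eval y (pderiv j q) = 0 := by
          have h := ih _ (auxW_stable f (T u) (hD u) n q hq) y hyA
          rw [auxD_apply] at h
          simpa [Matrix.mulVec, dotProduct] using h
        have h3 : ∑ j, (Pi.single i 1 : ι → F) j * eval y (pderiv j q) = 0 := by
          rw [hau]
          simp only [Pi.add_apply, add_mul, Finset.sum_add_distrib]
          rw [h1, h2, add_zero]
        simpa [Pi.single_apply] using h3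
      have hzero : auxLine x x₀ (pderiv i q) = 0 := by
        apply Polynomial.eq_zero_of_infinite_isRoot
        apply hS.infinite_compl.mono
        intro t ht
        change Polynomial.IsRoot _ t
        rw [Polynomial.IsRoot, auxLine_eval]
        exact hgen t ht
      have := auxLine_eval x x₀ (pderiv i q) 0
      rw [hzero] at this
      simpa using this.symm
  by_contra hf
  have hcoef : ∀ d : ℕ, ∀ n, ∀ p ∈ auxW f n, ∀ m : ι →₀ ℕ, m.degree = d → coeff m p = 0 := by
    intro d
    induction d with
    | zero =>
      intro n p hp m hm
      have : m = 0 := (Finsupp.degree_eq_zero_iff m).mp hm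
      subst this
      have := hW n p hp 0 A.zero_mem
      rwa [eval_zero, constantCoeff_eq] at this
    | succ d ih =>
      intro n p hp m hm
      have : m ≠ 0 := by rintro rfl; simp at hm
      obtain ⟨i, hi⟩ := Finsupp.ne_iff.mp this
      have hi' : m i ≠ 0 := hi
      have hm' : m = (m - Finsupp.single i 1) + Finsupp.single i 1 := by
        ext j; by_cases h : i = j
        · subst h; simp; omega
        · simp [h]
      have hdeg : (m - Finsupp.single i 1).degree = d := by
        rw [hm', map_add] at hm
        simpa using hm
      have h := ih (n+1) (pderiv i p) (auxW_mem f n i p hp) _ hdeg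
      rw [coeff_pderiv, ← hm'] at h
      rcases mul_eq_zero.mp h with h | h
      · exact h
      · exact absurd h (Nat.cast_add_one_ne_zero _)
  apply hf
  ext m
  exact hcoef _ 0 f (auxW_self f) m rfl

/-- first order deformation attached to a derivation -/
noncomputable def auxDual {R : Type*} [CommRing R] [Algebra F R] (D : Derivation F R R) :
    R →+* TrivSqZeroExt R R where
  toFun r := TrivSqZeroExt.inl r + TrivSqZeroExt.inr (D r)
  map_one' := by simp
  map_zero' := by simp
  map_add' a b := by ext <;> simp
  map_mul' a b := by ext <;> simp [mul_comm]

lemma aux_det_invariant [DecidableEq ι] {R : Type*} [CommRing R] [Algebra F R]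
    (D : Derivation F R R) (N P Q A : Matrix ι ι R)
    (hN : ∀ i j, D (N i j) = (A * N - N * A) i j) (hP : ∀ i j, D (P i j) = 0)
    (hQ : ∀ i j, D (Q i j) = 0)
    (hAP : A * P = P * A) (hAQ : A * Q = Q * A) : D (N * N * P + Q).det = 0 := by
  let φ := (auxDual D).mapMatrix (m := ι)
  let ψ := (TrivSqZeroExt.inlHom R R).mapMatrix (m := ι)
  let e : TrivSqZeroExt R R := TrivSqZeroExt.inr 1
  have he : e * e = 0 := by simp [e]
  have hee : ∀ X Y : Matrix ι ι (TrivSqZeroExt R R), (e • X) * (e • Y) = 0 := by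
    intro X Y
    rw [smul_mul_smul_comm, he, zero_smul]
  have key : ∀ M B : Matrix ι ι R, (∀ i j, D (M i j) = B i j) → φ M = ψ M + e • ψ B := by
    intro M B h
    ext i j
    · simp [φ, ψ, auxDual, e]
    · simp [φ, ψ, auxDual, e, h]
  have hφN : φ N = ψ N + e • (ψ A * ψ N - ψ N * ψ A) := by
    rw [key N _ hN, map_sub, map_mul, map_mul]
  have hφP : φ P = ψ P := by rw [key P 0 (by simpa using hP)]; simp
  have hφQ : φ Q = ψ Q := by rw [key Q 0 (by simpa using hQ)]; simp
  have hP' : ψ A * ψ P = ψ P * ψ A := by rw [← map_mul, hAP, map_mul]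
  have hQ' : ψ A * ψ Q = ψ Q * ψ A := by rw [← map_mul, hAQ, map_mul]
  set n := ψ N
  set a := ψ A
  set p := ψ P
  set q := ψ Q
  have hinv : (1 - e • a) * (1 + e • a) = 1 := by
    rw [sub_mul, one_mul, mul_add, mul_one, hee]; abel
  have hconj : ∀ X : Matrix ι ι (TrivSqZeroExt R R),
      (1 + e • a) * X * (1 - e • a) = X + e • (a * X - X * a) := by
    intro X
    have h1 : (e • a) * X * (e • a) = 0 := by rw [smul_mul_assoc, hee]
    rw [mul_sub, mul_one, add_mul, one_mul, add_mul, h1, smul_sub, smul_mul_assoc, mul_smul_comm]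
    abel
  have hdet : (φ (N * N * P + Q)).det = (ψ (N * N * P + Q)).det := by
    have h1 : φ (N * N * P + Q) = (1 + e • a) * ψ (N * N * P + Q) * (1 - e • a) := by
      have hp : (1 + e • a) * p * (1 - e • a) = p := by rw [hconj, hP']; simp
      have hq : (1 + e • a) * q * (1 - e • a) = q := by rw [hconj, hQ']; simp
      have hn : φ N = (1 + e • a) * n * (1 - e • a) := by rw [hconj, hφN]
      rw [map_add, map_mul, map_mul, hφP, hφQ, hn, map_add, map_mul, map_mul]
      change _ = (1 + e • a) * (n * n * p + q) * (1 - e • a)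
      conv_lhs => rw [← hp, ← hq]
      generalize 1 + e • a = u at *
      generalize 1 - e • a = v at *
      calc u * n * v * (u * n * v) * (u * p * v) + u * q * v
          = u * n * (v * u) * n * (v * u) * p * v + u * q * v := by simp only [mul_assoc]
        _ = u * (n * n * p + q) * v := by rw [hinv]; simp only [mul_one]; noncomm_ring
    rw [h1, Matrix.det_mul, Matrix.det_mul, mul_comm, ← mul_assoc, ← Matrix.det_mul, hinv,
      Matrix.det_one, one_mul]
  have h2 : (φ (N * N * P + Q)).det = auxDual D (N * N * P + Q).det :=
    ((auxDual D).map_det _).symm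
  have h3 : (ψ (N * N * P + Q)).det = TrivSqZeroExt.inlHom R R (N * N * P + Q).det :=
    ((TrivSqZeroExt.inlHom R R).map_det _).symm
  rw [h2, h3] at hdet
  have := congrArg TrivSqZeroExt.snd hdet
  simpa [auxDual] using this

end PolyHelpers

section Helpers3
set_option linter.unusedSectionVars false

variable {k g}

lemma aux_mem_eig {σ : g ≃ₗ⁅k⁆ g} {ε : k} {x : g} : x ∈ eigSub k g σ ε ↔ σ x = ε • x := by
  unfold eigSub
  rw [Module.End.mem_eigenspace_iff]
  rfl

lemma aux_ss_sq {h : Module.End k g} (hs : h.IsSemisimple) {v : g} (hv : h (h v) = 0) :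
    h v = 0 := by
  obtain ⟨q, hq, hc⟩ := Module.End.isSemisimple_iff.mp hs (LinearMap.ker h) (by
    intro v hv
    rw [Submodule.mem_comap, LinearMap.mem_ker, LinearMap.mem_ker.mp hv, map_zero])
  have hv' : v ∈ LinearMap.ker h ⊔ q := by rw [hc.sup_eq_top]; trivial
  obtain ⟨a, ha, b, hb, rfl⟩ := Submodule.mem_sup.mp hv'
  have ha' : h a = 0 := ha
  rw [map_add, ha', zero_add] at hv ⊢
  exact (Submodule.disjoint_def.mp hc.disjoint) (h b) hv (hq hb)

lemma aux_ss_decomp {h : Module.End k g} (hs : h.IsSemisimple) (v : g) :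
    ∃ a b, h a = 0 ∧ v = a + h b := by
  have hd : Disjoint (LinearMap.ker h) (LinearMap.range h) := by
    rw [Submodule.disjoint_def]
    rintro _ hx ⟨y, rfl⟩
    exact aux_ss_sq hs hx
  have ht := Submodule.eq_top_of_disjoint _ _ (by
    rw [add_comm, LinearMap.finrank_range_add_finrank_ker]) hd
  have hv : v ∈ LinearMap.ker h ⊔ LinearMap.range h := by rw [ht]; trivial
  obtain ⟨a, ha, _, ⟨b, rfl⟩, rfl⟩ := Submodule.mem_sup.mp hv
  exact ⟨a, b, ha, rfl⟩

lemma aux_kill_nil {n a : g} (hn : IsNilpotent (ad k g n)) (h : ⁅n, a⁆ = 0) :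
    killingForm k g n a = 0 := by
  rw [killingForm_apply_apply]
  exact (LinearMap.isNilpotent_trace_of_isNilpotent
    ((aux_ad_commute h).isNilpotent_mul_right hn)).eq_zero

lemma aux_kill_nondeg {w : g} (h : ∀ v, killingForm k g w v = 0) : w = 0 := by
  have : w ∈ LinearMap.ker (killingForm k g) := by
    rw [LinearMap.mem_ker]; ext v; exact h v
  rw [IsKilling.ker_killingForm_eq_bot] at this
  simpa using this

lemma aux_kill_comm (x y : g) : killingForm k g x y = killingForm k g y x :=
  LieModule.traceForm_comm k g g x y

lemma aux_kill_lie (x y z : g) : killingForm k g ⁅x, y⁆ z = killingForm k g x ⁅y, z⁆ :=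
  LieModule.traceForm_apply_lie_apply k g g x y z

/-- subspaces with a good projection -/
structure AuxGood (m : Submodule k g) (P : g →ₗ[k] g) : Prop where
  mem : ∀ v, P v ∈ m
  fix : ∀ v ∈ m, P v = v
  kill : ∀ w ∈ m, ∀ v, killingForm k g w (P v) = killingForm k g w v
  comm : ∀ x ∈ m, ∀ v, ⁅x, v⁆ = 0 → ⁅x, P v⁆ = 0
  jord : ∀ x ∈ m, ∀ n s : g, x = n + s → IsNilpotent (ad k g n) → IsSSElt k g s → ⁅n, s⁆ = 0 →
    s ∈ m

/-- projection to eigenspace -/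
noncomputable def auxP (σ : g ≃ₗ⁅k⁆ g) (ε : k) : g →ₗ[k] g :=
  (2⁻¹ : k) • (LinearMap.id + ε • (σ.toLinearEquiv : g →ₗ[k] g))

lemma auxP_apply (σ : g ≃ₗ⁅k⁆ g) (ε : k) (v : g) : auxP σ ε v = (2⁻¹ : k) • (v + ε • σ v) := rfl

lemma auxP_good (σ : g ≃ₗ⁅k⁆ g) (hσ : IsInvolution k g σ) (ε : k) (hε : ε * ε = 1) :
    AuxGood (eigSub k g σ ε) (auxP σ ε) where
  mem v := by
    rw [aux_mem_eig, auxP_apply]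
    simp only [map_smul, map_add, hσ v]
    rw [smul_comm ε, smul_add ε, smul_smul, hε, one_smul, add_comm]
  fix v hv := by
    rw [aux_mem_eig] at hv
    rw [auxP_apply, hv, smul_smul, hε, one_smul, ← two_smul k v, smul_smul,
      inv_mul_cancel₀ two_ne_zero, one_smul]
  kill w hw v := by
    rw [aux_mem_eig] at hw
    have h1 : killingForm k g w (σ v) = ε * killingForm k g w v := by
      rw [← killingForm_of_equiv_apply σ w (σ v), hσ v, hw]; simp
    rw [auxP_apply, map_smul, map_add, map_smul, h1, smul_eq_mul, smul_eq_mul, ← mul_assoc ε, hε]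
    field_simp
    ring
  comm x hx v hv := by
    rw [aux_mem_eig] at hx
    have h1 : ⁅x, σ v⁆ = 0 := by
      have : σ ⁅x, v⁆ = 0 := by rw [hv, map_zero]
      rw [LieEquiv.map_lie, hx, smul_lie] at this
      rcases smul_eq_zero.mp this with h | h
      · rw [h] at hε; simp at hε
      · exact h
    rw [auxP_apply]; simp [hv, h1]
  jord x hx n s h1 h2 h3 h4 := by
    rw [aux_mem_eig] at hx ⊢
    exact aux_jordan_sigma σ (by rintro rfl; simp at hε) h1 h2 h3 h4 hx

lemma auxGood_inf {m₁ m₂ : Submodule k g} {P₁ P₂ : g →ₗ[k] g} (h₁ : AuxGood m₁ P₁)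
    (h₂ : AuxGood m₂ P₂) (hc : ∀ v, P₁ (P₂ v) = P₂ (P₁ v)) : AuxGood (m₁ ⊓ m₂) (P₁ ∘ₗ P₂) where
  mem v := ⟨h₁.mem _, by rw [LinearMap.comp_apply, hc]; exact h₂.mem _⟩
  fix v hv := by rw [LinearMap.comp_apply, h₂.fix v hv.2, h₁.fix v hv.1]
  kill w hw v := by rw [LinearMap.comp_apply, h₁.kill w hw.1, h₂.kill w hw.2]
  comm x hx v hv := h₁.comm x hx.1 _ (h₂.comm x hx.2 v hv)
  jord x hx n s a b c d := ⟨h₁.jord x hx.1 n s a b c d, h₂.jord x hx.2 n s a b c d⟩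

lemma aux_extend {m c : Submodule k g} (hc : IsCartanSubspace k g m c) {s : g} (hsm : s ∈ m)
    (hs : IsSSElt k g s) (hsc : ∀ x ∈ c, ⁅x, s⁆ = 0) : s ∈ c := by
  obtain ⟨hcm, hcs, hca, hmax⟩ := hc
  have : c ⊔ Submodule.span k {s} = c := by
    apply hmax
    · exact sup_le hcm (by rw [Submodule.span_singleton_le_iff_mem]; exact hsm)
    · intro x hx
      obtain ⟨y, hy, z, hz, rfl⟩ := Submodule.mem_sup.mp hx
      obtain ⟨t, rfl⟩ := Submodule.mem_span_singleton.mp hz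
      unfold IsSSElt
      rw [map_add]
      apply Module.End.IsSemisimple.add_of_commute
      · apply aux_ad_commute; rw [lie_smul, hsc y hy, smul_zero]
      · exact hcs y hy
      · rw [map_smul]; exact Module.End.IsSemisimple_smul _ hs
    · intro x hx x' hx'
      obtain ⟨y, hy, z, hz, rfl⟩ := Submodule.mem_sup.mp hx
      obtain ⟨t, rfl⟩ := Submodule.mem_span_singleton.mp hz
      obtain ⟨y', hy', z', hz', rfl⟩ := Submodule.mem_sup.mp hx'
      obtain ⟨t', rfl⟩ := Submodule.mem_span_singleton.mp hz'
      have h1 : ⁅s, y'⁆ = 0 := by rw [← lie_skew, hsc y' hy', neg_zero]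
      simp [hca y hy y' hy', hsc y hy, h1]
    · exact le_sup_left
  rw [← this]
  exact Submodule.mem_sup_right (Submodule.mem_span_singleton_self s)

lemma aux_L5 {m c : Submodule k g} {P : g →ₗ[k] g} (hP : AuxGood m P)
    (hc : IsCartanSubspace k g m c) :
    (∀ y ∈ m, (∀ x ∈ c, ⁅x, y⁆ = 0) → y ∈ c) ∧
    (∀ a ∈ c, (∀ b ∈ c, killingForm k g a b = 0) → a = 0) := by
  have hc' := hc
  obtain ⟨hcm, hcs, hca, hmax⟩ := hc'
  obtain ⟨x, hx, hgen⟩ := aux_generic c hcs hca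
  have hnd : ∀ w ∈ m, (∀ x ∈ c, ⁅x, w⁆ = 0) →
      (∀ z ∈ m, (∀ x ∈ c, ⁅x, z⁆ = 0) → killingForm k g w z = 0) → w = 0 := by
    intro w hw hwc hwz
    apply aux_kill_nondeg (k := k)
    intro v
    obtain ⟨a, b, ha, rfl⟩ := aux_ss_decomp (hcs x hx) v
    have ha' : ⁅x, a⁆ = 0 := ha
    have h1 : killingForm k g w ⁅x, b⁆ = 0 := by
      rw [← aux_kill_lie, ← lie_skew, hwc x hx]; simp
    rw [map_add, show (ad k g x) b = ⁅x, b⁆ from rfl, h1, add_zero, ← hP.kill w hw]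
    refine hwz _ (hP.mem a) fun z hz => hP.comm z (hcm hz) a (hgen a ha' z hz)
  have hdec : ∀ y ∈ m, (∀ x ∈ c, ⁅x, y⁆ = 0) → ∃ n s : g, y = n + s ∧ IsNilpotent (ad k g n) ∧
      ⁅n, s⁆ = 0 ∧ (∀ z : g, ⁅y, z⁆ = 0 → ⁅s, z⁆ = 0) ∧ s ∈ c ∧ n ∈ m ∧ (∀ x ∈ c, ⁅x, n⁆ = 0) ∧
      (∀ x ∈ c, killingForm k g n x = 0) := by
    intro y hy hyc
    obtain ⟨n, s, h1, h2, h3, h4, h5⟩ := aux_jordan (k := k) y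
    have hsm : s ∈ m := hP.jord y hy n s h1 h2 h3 h4
    have hsx : ∀ x ∈ c, ⁅x, s⁆ = 0 := fun x hx => by
      rw [← lie_skew, h5 x (by rw [← lie_skew, hyc x hx, neg_zero]), neg_zero]
    have hn : n = y - s := by rw [h1]; abel
    have hnx : ∀ x ∈ c, ⁅x, n⁆ = 0 := fun x hx => by
      rw [hn, lie_sub, hyc x hx, hsx x hx, sub_zero]
    refine ⟨n, s, h1, h2, h4, h5, aux_extend hc hsm h3 hsx, hn ▸ m.sub_mem hy hsm, hnx, ?_⟩
    intro x hx
    exact aux_kill_nil h2 (by rw [← lie_skew, hnx x hx, neg_zero])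
  have hA : ∀ a ∈ c, (∀ b ∈ c, killingForm k g a b = 0) → a = 0 := by
    intro a ha hab
    refine hnd a (hcm ha) (fun x hx => hca x hx a ha) ?_
    intro z hz hzc
    obtain ⟨n, s, rfl, h2, h3, h4, h5, h6, h7, h8⟩ := hdec z hz hzc
    rw [map_add, hab s h5, add_zero, aux_kill_comm, h8 a ha]
  have hB : ∀ y ∈ m, (∀ x ∈ c, ⁅x, y⁆ = 0) → (∀ x ∈ c, killingForm k g y x = 0) →
      IsNilpotent (ad k g y) := by
    intro y hy hyc hyk
    obtain ⟨n, s, rfl, h2, h3, h4, h5, h6, h7, h8⟩ := hdec y hy hyc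
    have : s = 0 := hA s h5 fun b hb => by
      have := hyk b hb
      rwa [map_add, LinearMap.add_apply, h8 b hb, zero_add] at this
    rw [this, add_zero]; exact h2
  have hC : ∀ y ∈ m, (∀ x ∈ c, ⁅x, y⁆ = 0) → (∀ x ∈ c, killingForm k g y x = 0) → y = 0 := by
    intro y hy hyc hyk
    refine hnd y hy hyc ?_
    intro z hz hzc
    obtain ⟨n, s, rfl, h2, h3, h4, h5, h6, h7, h8⟩ := hdec z hz hzc
    rw [map_add, hyk s h5, add_zero]
    have e1 : killingForm k g (y + n) (y + n) = 0 := by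
      refine aux_kill_nil (hB _ (m.add_mem hy h6) ?_ ?_) (lie_self _)
      · intro x hx; rw [lie_add, hyc x hx, h7 x hx, add_zero]
      · intro x hx; rw [map_add, LinearMap.add_apply, hyk x hx, h8 x hx, add_zero]
    have e2 : killingForm k g y y = 0 := aux_kill_nil (hB y hy hyc hyk) (lie_self _)
    have e3 : killingForm k g n n = 0 := aux_kill_nil h2 (lie_self _)
    simp only [map_add, LinearMap.add_apply, e2, e3, aux_kill_comm n y, zero_add, add_zero] at e1
    rw [← two_mul] at e1
    exact (mul_eq_zero.mp e1).resolve_left two_ne_zero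
  refine ⟨?_, hA⟩
  intro y hy hyc
  obtain ⟨n, s, rfl, h2, h3, h4, h5, h6, h7, h8⟩ := hdec y hy hyc
  rw [hC n h6 h7 h8, zero_add]; exact h5

end Helpers3

section Helpers4
set_option linter.unusedSectionVars false
open MvPolynomial

lemma aux_lin_matrix {F : Type*} [Field F] {ι : Type*} [Fintype ι] [DecidableEq ι]
    (T A₀ : Matrix ι ι F) (M : ι → Matrix ι ι F)
    (h : ∀ m, ∑ l, T l m • M l = A₀ * M m - M m * A₀)
    (N A : Matrix ι ι (MvPolynomial ι F)) (hN : N = ∑ l, (X l : MvPolynomial ι F) • (M l).map C)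
    (hA : A = A₀.map C) (i j : ι) :
    auxD T (N i j) = (A * N - N * A) i j := by
  have h1 : A * N - N * A =
      ∑ m, (X m : MvPolynomial ι F) • (∑ l, T l m • M l).map C := by
    subst hN hA
    rw [Finset.mul_sum, Finset.sum_mul, ← Finset.sum_sub_distrib]
    refine Finset.sum_congr rfl fun m _ => ?_
    rw [h m, Matrix.mul_smul, Matrix.smul_mul, ← smul_sub]
    congr 1
    rw [← Matrix.map_mul, ← Matrix.map_mul]
    refine Matrix.ext fun a b => ?_
    simp only [Matrix.sub_apply, Matrix.map_apply, map_sub]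
  rw [h1, hN]
  simp only [Matrix.sum_apply, Matrix.smul_apply, Matrix.map_apply, smul_eq_mul, map_sum,
    Derivation.leibniz, auxD, mkDerivation_X, derivation_C, mul_zero, smul_zero, zero_add, map_mul,
    Finset.mul_sum]
  conv_rhs => rw [Finset.sum_comm]
  refine Finset.sum_congr rfl fun a _ => Finset.sum_congr rfl fun b _ => ?_
  ring

variable {k g}

lemma aux_L6 (σ : g ≃ₗ⁅k⁆ g) (hσ : IsInvolution k g σ) (hmax : IsMaxRank k g σ)
    (a : Submodule k g) (ha : IsCartanSubspace k g (eigSub k g σ (-1)) a) (w : g)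
    (hw : σ w = w) (hwa : ∀ x ∈ a, ⁅x, w⁆ = 0) : w = 0 := by
  classical
  by_contra hw0
  set PK := auxP σ 1 with hPK
  set PP := auxP σ (-1) with hPP
  have gK := auxP_good σ hσ 1 (by ring)
  have gP := auxP_good σ hσ (-1) (by ring)
  rw [← hPK] at gK
  rw [← hPP] at gP
  set K := eigSub k g σ 1 with hK
  set p := eigSub k g σ (-1) with hp
  have hsum : ∀ v, PK v + PP v = v := by
    intro v
    rw [hPK, hPP, auxP_apply, auxP_apply, ← smul_add, one_smul, neg_one_smul]
    rw [show v + σ v + (v + -σ v) = (2 : k) • v by rw [two_smul]; abel, smul_smul,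
      inv_mul_cancel₀ two_ne_zero, one_smul]
  have hKp : ∀ v ∈ K, PP v = 0 := by
    intro v hv
    have := hsum v
    rw [gK.fix v hv] at this
    simpa using this
  have hpK : ∀ v ∈ p, PK v = 0 := by
    intro v hv
    have := hsum v
    rw [gP.fix v hv] at this
    simpa using this
  have mK : ∀ {x}, x ∈ K ↔ σ x = x := by
    intro x; rw [hK, aux_mem_eig, one_smul]
  have mp : ∀ {x}, x ∈ p ↔ σ x = -x := by
    intro x; rw [hp, aux_mem_eig, neg_one_smul]
  have hwK : w ∈ K := mK.mpr hw
  have lKK : ∀ {x y}, x ∈ K → y ∈ K → ⁅x, y⁆ ∈ K := by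
    intro x y hx hy
    rw [mK] at *; rw [LieEquiv.map_lie, hx, hy]
  have lpK : ∀ {x y}, x ∈ p → y ∈ K → ⁅x, y⁆ ∈ p := by
    intro x y hx hy
    rw [mK] at hy; rw [mp] at *; rw [LieEquiv.map_lie, hx, hy, neg_lie]
  have lpp : ∀ {x y}, x ∈ p → y ∈ p → ⁅x, y⁆ ∈ K := by
    intro x y hx hy
    rw [mp] at *; rw [mK, LieEquiv.map_lie, hx, hy]; simp
  -- bracket with u in K commutes with the projections
  have uK : ∀ u ∈ K, ∀ v, PK ⁅u, v⁆ = ⁅u, PK v⁆ := by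
    intro u hu v
    rw [mK] at hu
    simp only [hPK, auxP_apply, LieEquiv.map_lie, hu, lie_smul, lie_add]
  have uP : ∀ u ∈ K, ∀ v, PP ⁅u, v⁆ = ⁅u, PP v⁆ := by
    intro u hu v
    rw [mK] at hu
    simp only [hPP, auxP_apply, LieEquiv.map_lie, hu, lie_smul, lie_add]
  -- the polynomial
  let b := Module.finBasis k g
  let n := Module.finrank k g
  let E : g ≃ₗ[k] (Fin n → k) := b.equivFun
  let tm : Module.End k g →ₗ[k] Matrix (Fin n) (Fin n) k := (LinearMap.toMatrix b b).toLinearMap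
  have tm_mul : ∀ f h : Module.End k g, tm (f * h) = tm f * tm h :=
    fun f h => LinearMap.toMatrix_mul b f h
  let M : Fin n → Matrix (Fin n) (Fin n) k := fun i => tm (ad k g (PP (b i)))
  let N : Matrix (Fin n) (Fin n) (MvPolynomial (Fin n) k) :=
    ∑ l, (X l : MvPolynomial (Fin n) k) • (M l).map C
  let f : MvPolynomial (Fin n) k := (N * N * (tm PK).map C + (tm PP).map C).det
  let L : g → Module.End k g := fun v => ad k g (PP v) * ad k g (PP v) * PK + PP
  have hL : ∀ v x, L v x = ⁅PP v, ⁅PP v, PK x⁆⁆ + PP x := fun v x => rfl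
  have hevN : ∀ v : g, (eval (E v)).mapMatrix N = tm (ad k g (PP v)) := by
    intro v
    have h1 : (eval (E v)).mapMatrix N = ∑ l, E v l • M l := by
      rw [map_sum]
      refine Finset.sum_congr rfl fun l _ => ?_
      ext i j
      simp
    rw [h1]
    conv_rhs => rw [← b.sum_equivFun v]
    simp only [map_sum, map_smul]
    rfl
  have hev : ∀ v : g, eval (E v) f = LinearMap.det (L v) := by
    intro v
    have hc : ∀ B : Matrix (Fin n) (Fin n) k, (eval (E v)).mapMatrix (B.map C) = B := by
      intro B; ext i j; simp
    change eval (E v) (Matrix.det _) = _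
    rw [RingHom.map_det, map_add, map_mul, map_mul, hevN, hc, hc, ← tm_mul, ← tm_mul, ← map_add]
    exact LinearMap.det_toMatrix b (L v)
  -- vanishing on a + K
  have hfA : ∀ v ∈ a ⊔ K, eval (E v) f = 0 := by
    intro v hv
    obtain ⟨x, hx, y, hy, rfl⟩ := Submodule.mem_sup.mp hv
    rw [hev]
    by_contra hne
    apply hw0
    have hinj : LinearMap.ker (L (x + y)) = ⊥ := by
      have := (LinearMap.equivOfDetNeZero (L (x+y)) hne).ker
      exact this
    have : w ∈ LinearMap.ker (L (x + y)) := by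
      rw [LinearMap.mem_ker, hL, map_add, hKp y hy, add_zero, gP.fix x (ha.1 hx), gK.fix w hwK,
        hwa x hx, lie_zero, hKp w hwK, add_zero]
    rw [hinj] at this
    simpa using this
  -- the generic element of a
  obtain ⟨x₀, hx₀, hgen⟩ := aux_generic a ha.2.1 ha.2.2.1
  have hza := (aux_L5 gP ha).1
  have hf0 : f = 0 := by
    refine aux_poly_main (U := K) ((a ⊔ K).map E.toLinearMap) (fun u => tm (ad k g (u : g))) f
      ?_ ?_ (E x₀) (Submodule.mem_map_of_mem (Submodule.mem_sup_left hx₀)) ?_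
    · rintro ⟨u, hu⟩
      refine aux_det_invariant (auxD (tm (ad k g u))) N _ _ ((tm (ad k g u)).map C) ?_ ?_ ?_ ?_ ?_
      · refine aux_lin_matrix (tm (ad k g u)) (tm (ad k g u)) M ?_ N _ rfl rfl
        intro m
        have e1 : ∑ l, tm (ad k g u) l m • M l = tm (ad k g (PP ⁅u, b m⁆)) := by
          conv_rhs => rw [← b.sum_equivFun ⁅u, b m⁆]
          simp only [map_sum, map_smul]
          refine Finset.sum_congr rfl fun l _ => ?_
          congr 1
          exact LinearMap.toMatrix_apply b b _ l m
        rw [e1, uP u hu, ← tm_mul, ← tm_mul, ← map_sub]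
        congr 1
        ext z
        simp [lie_lie]
      · intro i j; simp [auxD]
      · intro i j; simp [auxD]
      · rw [← Matrix.map_mul, ← Matrix.map_mul, ← tm_mul, ← tm_mul]
        congr 2
        ext z
        exact (uK u hu z).symm
      · rw [← Matrix.map_mul, ← Matrix.map_mul, ← tm_mul, ← tm_mul]
        congr 2
        ext z
        exact (uP u hu z).symm
    · rintro _ ⟨v, hv, rfl⟩
      exact hfA v hv
    · rintro _ ⟨v, hv, rfl⟩
      obtain ⟨x, hx, y, hy, rfl⟩ := Submodule.mem_sup.mp hv
      obtain ⟨S, hS, hS'⟩ := aux_finite_bad (ad k g x) (ad k g x₀)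
        (aux_ad_commute (ha.2.2.1 x hx x₀ hx₀)) (ha.2.1 x₀ hx₀)
      refine ⟨S, hS, fun t ht v' => ?_⟩
      have hle := hS' t ht
      obtain ⟨v, rfl⟩ := E.surjective v'
      have hxt : x + t • x₀ ∈ a := a.add_mem hx (a.smul_mem t hx₀)
      obtain ⟨z, q, hz, hzq⟩ := aux_ss_decomp (ha.2.1 _ hxt) (PP v)
      have hz1 : ⁅x + t • x₀, z⁆ = 0 := hz
      have hzq' : PP v = z + ⁅x + t • x₀, q⁆ := hzq
      have hz2 : ∀ y ∈ a, ⁅y, z⁆ = 0 := by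
        refine hgen z ?_
        have : z ∈ LinearMap.ker (ad k g x + t • ad k g x₀) := by
          rw [LinearMap.mem_ker]; simpa using hz1
        exact hle this
      have hz3 : PP z ∈ a := hza _ (gP.mem z) fun y hy => gP.comm y (ha.1 hy) z (hz2 y hy)
      have hq : PP ⁅x + t • x₀, q⁆ = ⁅x + t • x₀, PK q⁆ := by
        have h1 : ⁅x + t • x₀, q⁆ = ⁅x + t • x₀, PK q⁆ + ⁅x + t • x₀, PP q⁆ := by
          rw [← lie_add, hsum]
        rw [h1, map_add, gP.fix _ (lpK (ha.1 hxt) (gK.mem q)),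
          hKp _ (lpp (ha.1 hxt) (gP.mem q)), add_zero]
      have hv : PP v = PP z + ⁅x + t • x₀, PK q⁆ := by
        have := congrArg PP hzq'
        rwa [gP.fix _ (gP.mem v), map_add, hq] at this
      refine ⟨E (PP z + (PK v - ⁅-PK q, y⁆)), Submodule.mem_map_of_mem
        (Submodule.add_mem_sup hz3 (K.sub_mem (gK.mem v) (lKK (K.neg_mem (gK.mem q)) hy))),
        ⟨-PK q, K.neg_mem (gK.mem q)⟩, ?_⟩
      have h2 : (tm (ad k g (-PK q))).mulVec (E ((x + y) + t • x₀)) =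
          E ⁅-PK q, (x + y) + t • x₀⁆ :=
        LinearMap.toMatrix_mulVec_repr b b (ad k g (-PK q)) _
      change E v = E _ + (tm (ad k g (-PK q))).mulVec (E (x + y) + t • E x₀)
      rw [← map_smul, ← map_add, h2, ← map_add]
      congr 1
      have h3 : ⁅-PK q, (x + y) + t • x₀⁆ = ⁅x + t • x₀, PK q⁆ + ⁅-PK q, y⁆ := by
        rw [show (x + y) + t • x₀ = (x + t • x₀) + y by abel, lie_add, neg_lie, lie_skew]
      rw [h3]
      conv_lhs => rw [← hsum v, hv]
      abel
  -- nonvanishing at a generic point of the Cartan subalgebra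
  obtain ⟨H, hH, hHp⟩ := hmax
  have hHss : ∀ x ∈ H.toSubmodule, IsSSElt k g x := fun x hx =>
    IsKilling.isSemisimple_ad_of_mem_isCartanSubalgebra (H := H) hx
  have hHab : ∀ x ∈ H.toSubmodule, ∀ y ∈ H.toSubmodule, ⁅x, y⁆ = 0 := by
    intro x hx y hy
    have : ⁅(⟨x, hx⟩ : H), (⟨y, hy⟩ : H)⁆ = 0 := trivial_lie_zero H H _ _
    exact congrArg Subtype.val this
  obtain ⟨h, hh, hhgen⟩ := aux_generic H.toSubmodule hHss hHab
  have hdet : LinearMap.det (L h) = 0 := by rw [← hev, hf0, map_zero]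
  have hker := LinearMap.bot_lt_ker_of_det_eq_zero hdet
  obtain ⟨v, hv, hv0⟩ := Submodule.exists_mem_ne_zero_of_ne_bot hker.ne'
  apply hv0
  have hhp : h ∈ p := hHp hh
  rw [LinearMap.mem_ker, hL, gP.fix h hhp] at hv
  have hin : ⁅h, ⁅h, PK v⁆⁆ ∈ K := lpp hhp (lpK hhp (gK.mem v))
  have hPv : PP v = 0 := by
    have := congrArg PP hv
    rwa [map_add, hKp _ hin, gP.fix _ (gP.mem v), zero_add, map_zero] at this
  have hvK : PK v = v := by
    have := hsum v
    rwa [hPv, add_zero] at this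
  rw [hPv, add_zero, hvK] at hv
  have hhv : ⁅h, v⁆ = 0 := aux_ss_sq (hHss h hh) hv
  have hvH : v ∈ H := by
    rw [← hH.self_normalizing, LieSubalgebra.mem_normalizer_iff]
    intro y hy
    rw [← lie_skew, hhgen v hhv y hy, neg_zero]
    exact H.zero_mem
  have := gP.fix v (hHp hvH)
  rw [← this, hPv]

/-- Extension to a Cartan subspace. -/
lemma aux_exists_ext (m c : Submodule k g) (hcm : c ≤ m) (hs : ∀ x ∈ c, IsSSElt k g x)
    (hab : ∀ x ∈ c, ∀ y ∈ c, ⁅x, y⁆ = 0) : ∃ a, c ≤ a ∧ IsCartanSubspace k g m a := by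
  let S : Set (Submodule k g) := {a | c ≤ a ∧ a ≤ m ∧ (∀ x ∈ a, IsSSElt k g x) ∧
    ∀ x ∈ a, ∀ y ∈ a, ⁅x, y⁆ = 0}
  obtain ⟨a, ⟨h1, h2, h3, h4⟩, hmax⟩ := (wellFounded_gt (α := Submodule k g)).has_min S
    ⟨c, le_refl c, hcm, hs, hab⟩
  refine ⟨a, h1, h2, h3, h4, fun c' h5 h6 h7 h8 => ?_⟩
  by_contra hne
  exact hmax c' ⟨h1.trans h8, h5, h6, h7⟩ (lt_of_le_of_ne h8 (Ne.symm hne))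

end Helpers4

/-- If `σ₁` is of maximal rank, then any Cartan subspace of `g₁₀` is
also a Cartan subspace of `g₁₀ ⊕ g₀₁`, the `(-1)`-eigenspace of `σ₃ = σ₁σ₂`. -/
theorem cartanSubspace_g10_in_eigenspace_sigma3 (σ₁ σ₂ : g ≃ₗ⁅k⁆ g)
    (hcomm : CommutingInvolutions k g σ₁ σ₂)
    (hmax : IsMaxRank k g σ₁) :
    ∀ c : Submodule k g, IsCartanSubspace k g (qSpace k g σ₁ σ₂ true false) c →
      IsCartanSubspace k g
        (qSpace k g σ₁ σ₂ true false ⊔ qSpace k g σ₁ σ₂ false true) c := by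
  intro c hc
  obtain ⟨hi1, hi2, h12⟩ := hcomm
  have mem : ∀ {i j : Bool} {x : g}, x ∈ qSpace k g σ₁ σ₂ i j ↔
      σ₁ x = (if i then (-1 : k) else 1) • x ∧ σ₂ x = (if j then (-1 : k) else 1) • x := by
    intro i j x
    rw [qSpace, Submodule.mem_inf, aux_mem_eig, aux_mem_eig]
  have m10 : ∀ {x : g}, x ∈ qSpace k g σ₁ σ₂ true false ↔ σ₁ x = -x ∧ σ₂ x = x := by
    intro x; rw [mem]; simp
  have m01 : ∀ {x : g}, x ∈ qSpace k g σ₁ σ₂ false true ↔ σ₁ x = x ∧ σ₂ x = -x := by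
    intro x; rw [mem]; simp
  have good : AuxGood (qSpace k g σ₁ σ₂ true false) (auxP σ₁ (-1) ∘ₗ auxP σ₂ 1) := by
    have := auxGood_inf (auxP_good σ₁ hi1 (-1) (by ring)) (auxP_good σ₂ hi2 1 (by ring)) (by
      intro v
      simp only [auxP_apply, map_smul, map_add, h12]
      module)
    simpa [qSpace] using this
  obtain ⟨hz, hnd⟩ := aux_L5 good hc
  have hc' := hc
  obtain ⟨hcm, hcs, hca, hcmax⟩ := hc'
  have claim : ∀ y ∈ qSpace k g σ₁ σ₂ false true, (∀ x ∈ c, ⁅x, y⁆ = 0) → y = 0 := by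
    intro y hy hyc
    obtain ⟨hy1, hy2⟩ := m01.mp hy
    obtain ⟨a, hca', ha⟩ := aux_exists_ext (eigSub k g σ₁ (-1)) c
      (fun x hx => by rw [aux_mem_eig, (m10.mp (hcm hx)).1, neg_one_smul]) hcs hca
    refine aux_L6 σ₁ hi1 hmax a ha y hy1 ?_
    intro b hb
    have hb1 : σ₁ b = -b := by rw [aux_mem_eig.mp (ha.1 hb), neg_one_smul]
    have hbc : ∀ x ∈ c, ⁅x, b⁆ = 0 := fun x hx => ha.2.2.1 x (hca' hx) b hb
    have hbc2 : ∀ x ∈ c, ⁅x, σ₂ b⁆ = 0 := by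
      intro x hx
      have : σ₂ ⁅x, b⁆ = 0 := by rw [hbc x hx, map_zero]
      rwa [LieEquiv.map_lie, (m10.mp (hcm hx)).2] at this
    have h10 : b + σ₂ b ∈ c := by
      apply hz
      · rw [m10, map_add, map_add, hi2 b, h12, hb1, map_neg]
        exact ⟨by abel, by abel⟩
      · intro x hx; rw [lie_add, hbc x hx, hbc2 x hx, add_zero]
    have h11 : ⁅y, b - σ₂ b⁆ = 0 := by
      have hyb : ∀ x ∈ c, ⁅x, b - σ₂ b⁆ = 0 := by
        intro x hx; rw [lie_sub, hbc x hx, hbc2 x hx, sub_zero]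
      apply hnd
      · apply hz
        · rw [m10, LieEquiv.map_lie, LieEquiv.map_lie, map_sub, map_sub, hi2 b, h12, hb1, map_neg,
            hy1, hy2]
          constructor
          · rw [← lie_neg]; congr 1; abel
          · rw [neg_lie, ← lie_neg]; congr 1; abel
        · intro x hx
          rw [leibniz_lie, hyc x hx, hyb x hx, zero_lie, lie_zero, add_zero]
      · intro x hx
        rw [aux_kill_lie, ← lie_skew, hyb x hx, neg_zero, map_zero]
    have h2 : ⁅y, (2 : k) • b⁆ = 0 := by
      rw [show (2 : k) • b = (b + σ₂ b) + (b - σ₂ b) by rw [two_smul]; abel, lie_add, h11,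
        add_zero, ← lie_skew, hyc _ h10, neg_zero]
    rw [lie_smul] at h2
    rw [← lie_skew, (smul_eq_zero.mp h2).resolve_left two_ne_zero, neg_zero]
  refine ⟨hcm.trans le_sup_left, hcs, hca, ?_⟩
  intro c' hc'm hc's hc'a hcc'
  refine le_antisymm ?_ hcc'
  intro x hx
  obtain ⟨u, hu, v, hv, rfl⟩ := Submodule.mem_sup.mp (hc'm hx)
  obtain ⟨hu1, hu2⟩ := m10.mp hu
  obtain ⟨hv1, hv2⟩ := m01.mp hv
  have huv : ∀ z ∈ c, ⁅z, u⁆ = 0 ∧ ⁅z, v⁆ = 0 := by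
    intro z hz'
    have e1 : ⁅z, u⁆ + ⁅z, v⁆ = 0 := by rw [← lie_add]; exact hc'a z (hcc' hz') _ hx
    have e2 : ⁅z, u⁆ - ⁅z, v⁆ = 0 := by
      have := congrArg σ₁ e1
      rw [map_add, LieEquiv.map_lie, LieEquiv.map_lie, hu1, hv1, (m10.mp (hcm hz')).1,
        map_zero] at this
      simpa [sub_eq_add_neg] using this
    have e3 : ⁅z, u⁆ = ⁅z, v⁆ := sub_eq_zero.mp e2
    rw [e3, ← two_smul k] at e1
    have e4 := (smul_eq_zero.mp e1).resolve_left two_ne_zero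
    exact ⟨e3.trans e4, e4⟩
  have hv0 : v = 0 := claim v hv fun z hz' => (huv z hz').2
  rw [hv0, add_zero]
  exact hz u hu fun z hz' => (huv z hz').1
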